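/- (Self-pairing of the destabilizing quotient character.) With e_α, e_γ, e_β the exceptional characters associated to (p−1)/2ⁿ, p/2ⁿ and (p+1)/2ⁿ respectively, let n₁, n₂ ∈ ℝ and set w := n₂·e_α − n₁·τ(e_β) and P := e_γ − (3·ch₀(e_β) − n₂)·e_α. Then χ(w − P, w − P) = n₁² − 3·ch₀(e_α)·n₁ + 1; in particular, if 1 ≤ n₁ ≤ 3·ch₀(e_α) − 1 then χ(w − P, w − P) < 0. -/

import Mathlib

/-- The Euler pairing (Hirzebruch–Riemann–Roch on P²) on `K(P²)⊗ℝ ≅ ℝ³`,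
identifying `v = (ch₀ v, ch₁ v, ch₂ v)`. -/
noncomputable def chi (v w : ℝ × ℝ × ℝ) : ℝ :=
  v.2.2 * w.1 + w.2.2 * v.1 - v.2.1 * w.2.1 + (3 / 2) * (w.2.1 * v.1 - w.1 * v.2.1) + v.1 * w.1

/-- The Serre twist `τ(v)`, the Chern character of `V ⊗ O(−3)`. -/
noncomputable def tau (v : ℝ × ℝ × ℝ) : ℝ × ℝ × ℝ :=
  (v.1, v.2.1 - 3 * v.1, v.2.2 - 3 * v.2.1 + (9 / 2) * v.1)

/-- `vtil m p` is the exceptional character `ṽ(p / 2^m) ∈ ℝ³`, defined recursively: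
`ṽ(n) = (1, n, n²/2)` for integers `n`; for odd `p` and `m > 0`,
if `p ≡ 3 (mod 4)` then `ṽ(p/2^m) = 3·ch₀(ṽ((p+1)/2^m))·ṽ((p−1)/2^m) − ṽ((p−3)/2^m)`,
and if `p ≡ 1 (mod 4)` then `ṽ(p/2^m) = 3·ch₀(ṽ((p−1)/2^m))·ṽ((p+1)/2^m) − ṽ((p+3)/2^m)`.
For even `p` we reduce the fraction, so `vtil` is well defined on dyadic rationals
(each dyadic rational `q` is represented as `p / 2^m`). -/
noncomputable def vtil : ℕ → ℤ → ℝ × ℝ × ℝ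
  | 0, p => (1, (p : ℝ), (p : ℝ) ^ 2 / 2)
  | m + 1, p =>
    if p % 2 = 0 then vtil m (p / 2)
    else if p % 4 = 3 then
      (3 * (vtil m ((p + 1) / 2)).1) • vtil m ((p - 1) / 2) - vtil m ((p - 3) / 2)
    else
      (3 * (vtil m ((p - 1) / 2)).1) • vtil m ((p + 1) / 2) - vtil m ((p + 3) / 2)

section EulerPairing

variable (u v w : ℝ × ℝ × ℝ) (r : ℝ)

theorem chi_sub_left : chi (u - v) w = chi u w - chi v w := by
  simp only [chi, Prod.fst_sub, Prod.snd_sub]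
  ring

theorem chi_sub_right : chi u (v - w) = chi u v - chi u w := by
  simp only [chi, Prod.fst_sub, Prod.snd_sub]
  ring

theorem chi_smul_left : chi (r • u) v = r * chi u v := by
  simp only [chi, Prod.smul_fst, Prod.smul_snd, smul_eq_mul]
  ring

theorem chi_smul_right : chi u (r • v) = r * chi u v := by
  simp only [chi, Prod.smul_fst, Prod.smul_snd, smul_eq_mul]
  ring

/-- Numerical Serre duality. -/
theorem chi_tau_right : chi u (tau v) = chi v u := by
  simp only [chi, tau]
  ring

theorem chi_tau_left : chi (tau u) v = 9 * u.1 * v.1 + 2 * chi u v - chi v u := by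
  simp only [chi, tau]
  ring

end EulerPairing

/-- The numerical properties of an exceptional triple `(a, g, b)`: its Gram matrix for the Euler
pairing in terms of the ranks, together with the maximality of the middle rank. -/
structure IsNumExceptionalTriple (a g b : ℝ × ℝ × ℝ) : Prop where
  chi_a_a : chi a a = 1
  chi_g_g : chi g g = 1
  chi_b_b : chi b b = 1
  chi_g_a : chi g a = 0
  chi_b_g : chi b g = 0
  chi_b_a : chi b a = 0
  chi_a_g : chi a g = 3 * b.1
  chi_g_b : chi g b = 3 * a.1
  chi_a_b : chi a b = 9 * a.1 * b.1 - 3 * g.1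
  one_le_a : 1 ≤ a.1
  one_le_b : 1 ≤ b.1
  a_le_g : a.1 ≤ g.1
  b_le_g : b.1 ≤ g.1

namespace IsNumExceptionalTriple

variable {a g b : ℝ × ℝ × ℝ}

theorem mutate_left (h : IsNumExceptionalTriple a g b) :
    IsNumExceptionalTriple a ((3 * a.1) • g - b) g := by
  obtain ⟨haa, hgg, hbb, hga, hbg, hba, hag, hgb, hab, ha, hb, hag', hbg'⟩ := h
  constructor <;>
    (try simp only [chi_sub_left, chi_sub_right, chi_smul_left, chi_smul_right, haa, hgg, hbb, hga,
      hbg, hba, hag, hgb, hab, Prod.fst_sub, Prod.smul_fst, smul_eq_mul]) <;>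
    first | ring1 | nlinarith

theorem mutate_right (h : IsNumExceptionalTriple a g b) :
    IsNumExceptionalTriple g ((3 * b.1) • g - a) b := by
  obtain ⟨haa, hgg, hbb, hga, hbg, hba, hag, hgb, hab, ha, hb, hag', hbg'⟩ := h
  constructor <;>
    (try simp only [chi_sub_left, chi_sub_right, chi_smul_left, chi_smul_right, haa, hgg, hbb, hga,
      hbg, hba, hag, hgb, hab, Prod.fst_sub, Prod.smul_fst, smul_eq_mul]) <;>
    first | ring1 | nlinarith

theorem chi_quotient_self (h : IsNumExceptionalTriple a g b) (r : ℝ) :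
    chi ((3 * b.1) • a - g - r • tau b) ((3 * b.1) • a - g - r • tau b) =
      r ^ 2 - 3 * a.1 * r + 1 := by
  simp only [chi_sub_left, chi_sub_right, chi_smul_left, chi_smul_right, chi_tau_right,
    chi_tau_left, h.chi_a_a, h.chi_g_g, h.chi_b_b, h.chi_g_a, h.chi_b_g, h.chi_b_a,
    h.chi_a_g, h.chi_g_b, h.chi_a_b]
  ring

end IsNumExceptionalTriple

theorem vtil_succ_two_mul (m : ℕ) (q : ℤ) : vtil (m + 1) (2 * q) = vtil m q := by
  rw [vtil, if_pos (by omega), show 2 * q / 2 = q by omega]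

theorem vtil_succ_four_mul_add_one (m : ℕ) (k : ℤ) :
    vtil (m + 1) (4 * k + 1) =
      (3 * (vtil m (2 * k)).1) • vtil m (2 * k + 1) - vtil m (2 * k + 2) := by
  rw [vtil, if_neg (by omega), if_neg (by omega), show (4 * k + 1 - 1) / 2 = 2 * k by omega,
    show (4 * k + 1 + 1) / 2 = 2 * k + 1 by omega, show (4 * k + 1 + 3) / 2 = 2 * k + 2 by omega]

theorem vtil_succ_four_mul_add_three (m : ℕ) (k : ℤ) :
    vtil (m + 1) (4 * k + 3) =
      (3 * (vtil m (2 * k + 2)).1) • vtil m (2 * k + 1) - vtil m (2 * k) := by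
  rw [vtil, if_neg (by omega), if_pos (by omega), show (4 * k + 3 - 1) / 2 = 2 * k + 1 by omega,
    show (4 * k + 3 + 1) / 2 = 2 * k + 2 by omega, show (4 * k + 3 - 3) / 2 = 2 * k by omega]

theorem isNumExceptionalTriple_vtil (n : ℕ) (p : ℤ) (hp : 0 < n → Odd p) :
    IsNumExceptionalTriple (vtil n (p - 1)) (vtil n p) (vtil n (p + 1)) := by
  induction n generalizing p with
  | zero => constructor <;> simp only [vtil, chi] <;> push_cast <;> first | ring1 | norm_num
  | succ m ih =>
    have hodd := hp m.succ_pos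
    have triple (k : ℤ) :
        IsNumExceptionalTriple (vtil m (2 * k)) (vtil m (2 * k + 1)) (vtil m (2 * k + 2)) := by
      simpa [add_assoc] using ih (2 * k + 1) fun _ => odd_two_mul_add_one k
    obtain ⟨k, rfl | rfl⟩ : ∃ k, p = 4 * k + 1 ∨ p = 4 * k + 3 :=
      ⟨p / 4, by have := Int.odd_iff.mp hodd; omega⟩
    · rw [vtil_succ_four_mul_add_one, show 4 * k + 1 - 1 = 2 * (2 * k) by ring,
        show 4 * k + 1 + 1 = 2 * (2 * k + 1) by ring, vtil_succ_two_mul, vtil_succ_two_mul]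
      exact (triple k).mutate_left
    · rw [vtil_succ_four_mul_add_three, show 4 * k + 3 - 1 = 2 * (2 * k + 1) by ring,
        show 4 * k + 3 + 1 = 2 * (2 * k + 2) by ring, vtil_succ_two_mul, vtil_succ_two_mul]
      exact (triple k).mutate_right

/-- Self-pairing of the destabilizing quotient character: with `e_α = ṽ((p−1)/2ⁿ)`,
`e_γ = ṽ(p/2ⁿ)`, `e_β = ṽ((p+1)/2ⁿ)` (`p` odd when `n > 0`),
`w = n₂·e_α − n₁·τ(e_β)` and `P = e_γ − (3·ch₀(e_β) − n₂)·e_α`: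
`χ(w − P, w − P) = n₁² − 3·ch₀(e_α)·n₁ + 1`; in particular, if
`1 ≤ n₁ ≤ 3·ch₀(e_α) − 1` then `χ(w − P, w − P) < 0`. -/
theorem destabilizing_quotient_selfpairing (n : ℕ) (p : ℤ) (hp : 0 < n → Odd p)
    (n₁ n₂ : ℝ) (w P : ℝ × ℝ × ℝ)
    (hw : w = n₂ • vtil n (p - 1) - n₁ • tau (vtil n (p + 1)))
    (hP : P = vtil n p - (3 * (vtil n (p + 1)).1 - n₂) • vtil n (p - 1)) :
    chi (w - P) (w - P) = n₁ ^ 2 - 3 * (vtil n (p - 1)).1 * n₁ + 1 ∧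
    (1 ≤ n₁ → n₁ ≤ 3 * (vtil n (p - 1)).1 - 1 → chi (w - P) (w - P) < 0) := by
  have h := isNumExceptionalTriple_vtil n p hp
  have hwP : w - P =
      (3 * (vtil n (p + 1)).1) • vtil n (p - 1) - vtil n p - n₁ • tau (vtil n (p + 1)) := by
    rw [hw, hP]
    module
  have hchi := h.chi_quotient_self n₁
  rw [← hwP] at hchi
  refine ⟨hchi, fun h₁ h₂ => ?_⟩
  rw [hchi]
  nlinarith [h.one_le_a, mul_nonneg (sub_nonneg.mpr h₁) (sub_nonneg.mpr h₂)]
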